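/- Let H be a nonzero complex Hilbert space and let A be a bounded linear operator on H. Then (1/2)·‖Re(A²)‖ + (1/2)·w(A)·| ‖Re(A)‖ − ‖Im(A)‖ | ≤ w(A)² ≤ (1/2)·w(|A| + i|A*|)·w(|A*| + i|A|). -/

import Mathlib

open scoped InnerProductSpace
open ContinuousLinearMap

variable {H : Type*} [NormedAddCommGroup H] [InnerProductSpace ℂ H]
  [CompleteSpace H] [Nontrivial H]

/-- The numerical radius of a bounded linear operator. -/
noncomputable def numRad (A : H →L[ℂ] H) : ℝ :=
  ⨆ x : {x : H // ‖x‖ = 1}, ‖⟪A x.1, x.1⟫_ℂ‖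

/-- The Crawford number of a bounded linear operator. -/
noncomputable def crawford (A : H →L[ℂ] H) : ℝ :=
  ⨅ x : {x : H // ‖x‖ = 1}, ‖⟪A x.1, x.1⟫_ℂ‖

/-- The Euclidean operator radius of a pair of bounded linear operators. -/
noncomputable def euclRad (B C : H →L[ℂ] H) : ℝ :=
  ⨆ x : {x : H // ‖x‖ = 1}, Real.sqrt (‖⟪B x.1, x.1⟫_ℂ‖ ^ 2 + ‖⟪C x.1, x.1⟫_ℂ‖ ^ 2)

/-- The absolute value `|A| = (A*A)^(1/2)` of a bounded linear operator. -/
noncomputable def opAbs (A : H →L[ℂ] H) : H →L[ℂ] H := CFC.sqrt (adjoint A * A)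

/-- The real part `Re(A) = (A + A*)/2` of a bounded linear operator. -/
noncomputable def reOp (A : H →L[ℂ] H) : H →L[ℂ] H := (2 : ℂ)⁻¹ • (A + adjoint A)

/-- The imaginary part `Im(A) = (A - A*)/(2i)` of a bounded linear operator. -/
noncomputable def imOp (A : H →L[ℂ] H) : H →L[ℂ] H := (2 * Complex.I)⁻¹ • (A - adjoint A)

set_option linter.unusedSectionVars false

open scoped ComplexOrder

/-- For nonnegative `P` and `Q`, the equation `QX = -XP` forces `XP = 0`. -/
lemma mul_eq_zero_of_mul_eq_neg_mul {P Q X : H →L[ℂ] H} (hP : 0 ≤ P) (hQ : 0 ≤ Q)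
    (h : Q * X = -(X * P)) : X * P = 0 := by
  have hPs : star P = P := (IsSelfAdjoint.of_nonneg hP).star_eq
  have hX : 0 ≤ star X * X := star_mul_self_nonneg X
  have hXs : star (star X * X) = star X * X := by simp
  have hconj : 0 ≤ star X * Q * X := star_left_conjugate_nonneg hQ X
  have key : star X * Q * X = -(star X * X * P) := by
    rw [mul_assoc, h, mul_neg, mul_assoc]
  have hsa : star (star X * X * P) = star X * X * P := by
    have := (IsSelfAdjoint.of_nonneg hconj).star_eq
    rw [key, star_neg] at this
    exact neg_injective this
  have hcomm : Commute (star X * X) P := by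
    rw [star_mul, hPs, hXs] at hsa
    exact hsa.symm
  have hnonneg : 0 ≤ star X * X * P := Commute.mul_nonneg hX hP hcomm
  have hzero : star X * X * P = 0 := by
    rw [key] at hconj
    exact le_antisymm (neg_nonneg.1 hconj) hnonneg
  rw [← CStarRing.star_mul_self_eq_zero_iff, star_mul, hPs, mul_assoc, ← mul_assoc (star X), hzero,
    mul_zero]

lemma opAbs_nonneg (A : H →L[ℂ] H) : 0 ≤ opAbs A := CFC.sqrt_nonneg _

lemma opAbs_mul_self (A : H →L[ℂ] H) : opAbs A * opAbs A = star A * A :=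
  CFC.sqrt_mul_sqrt_self _ (star_mul_self_nonneg A)

lemma opAbs_adjoint_mul_self (A : H →L[ℂ] H) :
    opAbs (adjoint A) * opAbs (adjoint A) = A * star A := by
  rw [opAbs_mul_self, ← star_eq_adjoint, star_star]

/-- `A` intertwines `|A|` and `|A*|`. -/
lemma mul_opAbs (A : H →L[ℂ] H) : A * opAbs A = opAbs (adjoint A) * A := by
  have hP := opAbs_nonneg A
  have hQ := opAbs_nonneg (adjoint A)
  have hPP := opAbs_mul_self A
  have hQQ := opAbs_adjoint_mul_self A
  set P := opAbs A
  set Q := opAbs (adjoint A)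
  have hPs : star P = P := (IsSelfAdjoint.of_nonneg hP).star_eq
  have hQs : star Q = Q := (IsSelfAdjoint.of_nonneg hQ).star_eq
  have hsylv : Q * (A * P - Q * A) = -((A * P - Q * A) * P) := by
    have h₁ : Q * (Q * A) = A * (P * P) := by rw [← mul_assoc, hQQ, hPP, mul_assoc]
    rw [mul_sub, sub_mul, h₁, neg_sub]
    simp only [mul_assoc]
  have hXP := mul_eq_zero_of_mul_eq_neg_mul hP hQ hsylv
  rw [hXP, neg_zero] at hsylv
  rw [← sub_eq_zero]
  set X := A * P - Q * A with hX
  have hAX : star A * X = 0 := by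
    rw [← CStarRing.star_mul_self_eq_zero_iff, star_mul, star_star, mul_assoc, ← mul_assoc A, ← hQQ,
      mul_assoc, hsylv, mul_zero, mul_zero]
  have hXstar : star X = P * star A - star A * Q := by
    rw [hX, star_sub, star_mul, star_mul, hPs, hQs]
  rw [← CStarRing.star_mul_self_eq_zero_iff, hXstar, sub_mul, mul_assoc, mul_assoc, hAX, hsylv,
    mul_zero, mul_zero, sub_zero]

lemma inner_mul_self_of_isSelfAdjoint {S : H →L[ℂ] H} (hS : IsSelfAdjoint S) (x y : H) :
    ⟪(S * S) x, y⟫_ℂ = ⟪S x, S y⟫_ℂ := by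
  rw [mul_apply_eq_comp, ← adjoint_inner_right S, hS.adjoint_eq]

/-- The Cauchy–Schwarz inequality for the form of a nonnegative operator. -/
lemma norm_inner_sq_le_of_nonneg {T : H →L[ℂ] H} (hT : 0 ≤ T) (x z : H) :
    ‖⟪T x, z⟫_ℂ‖ ^ 2 ≤ (⟪T x, x⟫_ℂ).re * (⟪T z, z⟫_ℂ).re := by
  have hS : IsSelfAdjoint (CFC.sqrt T) := .of_nonneg (CFC.sqrt_nonneg T)
  have hinner (a b : H) : ⟪T a, b⟫_ℂ = ⟪CFC.sqrt T a, CFC.sqrt T b⟫_ℂ := by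
    rw [← inner_mul_self_of_isSelfAdjoint hS, CFC.sqrt_mul_sqrt_self T hT]
  rw [hinner, hinner, hinner]
  have h := norm_inner_le_norm (𝕜 := ℂ) (CFC.sqrt T x) (CFC.sqrt T z)
  have hself (a : H) : (⟪a, a⟫_ℂ).re = ‖a‖ ^ 2 := inner_self_eq_norm_sq (𝕜 := ℂ) a
  rw [hself, hself, ← mul_pow]
  gcongr

lemma isUnit_add_smul_one {P : H →L[ℂ] H} (hP : 0 ≤ P) {ε : ℝ} (hε : 0 < ε) :
    IsUnit (P + (ε : ℂ) • (1 : H →L[ℂ] H)) := by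
  refine isUnit_of_forall_le_norm_inner_map _ (c := ⟨ε, hε.le⟩) hε fun x ↦ ?_
  have h : 0 ≤ (⟪P x, x⟫_ℂ).re :=
    ((nonneg_iff_isPositive P).1 hP).re_inner_nonneg_left x
  refine le_trans ?_ (Complex.re_le_norm _)
  have hself : (⟪x, x⟫_ℂ).re = ‖x‖ ^ 2 := inner_self_eq_norm_sq (𝕜 := ℂ) x
  simp only [add_apply, smul_apply, one_apply_eq_self, inner_add_left, inner_smul_left, Complex.conj_ofReal,
    Complex.add_re, Complex.re_ofReal_mul, hself]
  change ‖x‖ ^ 2 * ε ≤ _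
  linarith

/-- The mixed Schwarz inequality. -/
lemma norm_inner_sq_le_opAbs (A : H →L[ℂ] H) (x y : H) :
    ‖⟪A x, y⟫_ℂ‖ ^ 2 ≤ (⟪opAbs A x, x⟫_ℂ).re * (⟪opAbs (adjoint A) y, y⟫_ℂ).re := by
  have hP := opAbs_nonneg A
  have hQ := opAbs_nonneg (adjoint A)
  have hQQ := opAbs_adjoint_mul_self A
  have hint := mul_opAbs A
  set P := opAbs A
  set Q := opAbs (adjoint A)
  have hself (a : H) : (⟪a, a⟫_ℂ).re = ‖a‖ ^ 2 := inner_self_eq_norm_sq (𝕜 := ℂ) a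
  have hQpos (a : H) : 0 ≤ (⟪Q a, a⟫_ℂ).re :=
    ((nonneg_iff_isPositive Q).1 hQ).re_inner_nonneg_left a
  have hQs (a b : H) : ⟪Q a, b⟫_ℂ = ⟪a, Q b⟫_ℂ :=
    ((nonneg_iff_isPositive Q).1 hQ).inner_left_eq_inner_right a b
  have hbound (ε : ℝ) (hε : 0 < ε) : ‖⟪A x, y⟫_ℂ‖ ^ 2 ≤
      ((⟪P x, x⟫_ℂ).re + ε * ‖x‖ ^ 2) * (⟪Q y, y⟫_ℂ).re := by
    have hT : 0 ≤ P + (ε : ℂ) • (1 : H →L[ℂ] H) :=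
      add_nonneg hP (smul_nonneg (Complex.zero_le_real.2 hε.le) zero_le_one)
    obtain ⟨z, hz⟩ := ((isUnit_iff_bijective).1 (isUnit_add_smul_one hP hε)).2 (adjoint A y)
    have hbij := (isUnit_iff_bijective).1 (isUnit_add_smul_one hQ hε)
    obtain ⟨v, hv⟩ := hbij.2 y
    have hAz : A z = Q (Q v) := by
      apply hbij.1
      have h₁ : (Q + (ε : ℂ) • (1 : H →L[ℂ] H)) (A z) = A ((P + (ε : ℂ) • (1 : H →L[ℂ] H)) z) := by
        have := DFunLike.congr_fun hint z
        simp only [mul_apply_eq_comp] at this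
        simp [this]
      have h₂ : A (adjoint A y) = Q (Q y) := DFunLike.congr_fun hQQ.symm y
      rw [h₁, hz, h₂, ← hv]
      simp
    have hCS := norm_inner_sq_le_of_nonneg hT x z
    have hle : (⟪(P + (ε : ℂ) • (1 : H →L[ℂ] H)) z, z⟫_ℂ).re ≤ (⟪Q y, y⟫_ℂ).re := by
      rw [hz, adjoint_inner_left, hAz, hQs y y]
      have hvε : y = Q v + (ε : ℂ) • v := by rw [← hv]; simp
      have hQy : Q y = Q (Q v) + (ε : ℂ) • Q v := by rw [hvε]; simp
      rw [hQy, inner_add_right, Complex.add_re, inner_smul_right, Complex.re_ofReal_mul]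
      have : 0 ≤ (⟪y, Q v⟫_ℂ).re := by
        rw [hvε, inner_add_left, inner_smul_left, Complex.conj_ofReal, Complex.add_re,
          Complex.re_ofReal_mul, hself, ← hQs]
        have := hQpos v
        positivity
      have := mul_nonneg hε.le this
      linarith
    have hx : (⟪(P + (ε : ℂ) • (1 : H →L[ℂ] H)) x, x⟫_ℂ).re = (⟪P x, x⟫_ℂ).re + ε * ‖x‖ ^ 2 := by
      simp only [add_apply, smul_apply, one_apply_eq_self, inner_add_left, inner_smul_left,
        Complex.conj_ofReal, Complex.add_re, Complex.re_ofReal_mul, hself]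
    have hAxy : ⟪(P + (ε : ℂ) • (1 : H →L[ℂ] H)) x, z⟫_ℂ = ⟪A x, y⟫_ℂ := by
      rw [((nonneg_iff_isPositive _).1 hT).inner_left_eq_inner_right, hz, adjoint_inner_right]
    have hPx : 0 ≤ (⟪P x, x⟫_ℂ).re :=
      ((nonneg_iff_isPositive P).1 hP).re_inner_nonneg_left x
    rw [hAxy, hx] at hCS
    exact hCS.trans (by gcongr)
  have hlim : Filter.Tendsto
      (fun ε : ℝ ↦ ((⟪P x, x⟫_ℂ).re + ε * ‖x‖ ^ 2) * (⟪Q y, y⟫_ℂ).re)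
      (nhdsWithin 0 (Set.Ioi 0)) (nhds ((⟪P x, x⟫_ℂ).re * (⟪Q y, y⟫_ℂ).re)) := by
    have : Continuous (fun ε : ℝ ↦ ((⟪P x, x⟫_ℂ).re + ε * ‖x‖ ^ 2) * (⟪Q y, y⟫_ℂ).re) := by
      fun_prop
    simpa using (this.tendsto 0).mono_left nhdsWithin_le_nhds
  exact ge_of_tendsto hlim (Filter.eventually_of_mem self_mem_nhdsWithin hbound)

lemma norm_inner_le_numRad (A : H →L[ℂ] H) {x : H} (hx : ‖x‖ = 1) :
    ‖⟪A x, x⟫_ℂ‖ ≤ numRad A := by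
  refine le_ciSup (f := fun x : {x : H // ‖x‖ = 1} ↦ ‖⟪A x.1, x.1⟫_ℂ‖) ⟨‖A‖, ?_⟩ ⟨x, hx⟩
  rintro _ ⟨⟨y, hy⟩, rfl⟩
  have h := A.le_opNorm y
  have h' := norm_inner_le_norm (𝕜 := ℂ) (A y) y
  simp only [hy, mul_one] at h h' ⊢
  exact h'.trans h

lemma numRad_nonneg (A : H →L[ℂ] H) : 0 ≤ numRad A :=
  Real.iSup_nonneg fun _ ↦ norm_nonneg _

lemma numRad_le {A : H →L[ℂ] H} {r : ℝ} (h : ∀ x : H, ‖x‖ = 1 → ‖⟪A x, x⟫_ℂ‖ ≤ r) :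
    numRad A ≤ r := by
  obtain ⟨x, hx⟩ := exists_norm_eq H zero_le_one
  have : Nonempty {x : H // ‖x‖ = 1} := ⟨⟨x, hx⟩⟩
  exact ciSup_le fun x ↦ h x.1 x.2

/-- A bound for the quadratic form of a self-adjoint operator on unit vectors bounds its norm. -/
lemma norm_le_of_isSelfAdjoint {T : H →L[ℂ] H} (hT : IsSelfAdjoint T) {r : ℝ}
    (h : ∀ x : H, ‖x‖ = 1 → ‖⟪T x, x⟫_ℂ‖ ≤ r) : ‖T‖ ≤ r := by
  have hr : 0 ≤ r := (numRad_nonneg T).trans (numRad_le h)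
  rw [norm_eq_iSup_rayleighQuotient T hT.isSymmetric]
  refine ciSup_le fun x ↦ ?_
  rcases eq_or_ne x 0 with rfl | hx
  · simpa using hr
  · have hx' : ‖x‖ ≠ 0 := norm_ne_zero_iff.2 hx
    have hunit : ‖((‖x‖⁻¹ : ℝ) : ℂ) • x‖ = 1 := by simp [norm_smul, hx']
    have hx'' : ((‖x‖⁻¹ : ℝ) : ℂ) ≠ 0 := by simpa using hx
    rw [← rayleigh_smul T x hx'']
    have := (Complex.abs_re_le_norm _).trans (h _ hunit)
    rw [rayleighQuotient, reApplyInnerSelf_apply, hunit, one_pow, div_one]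
    exact this

lemma isSelfAdjoint_reOp (A : H →L[ℂ] H) : IsSelfAdjoint (reOp A) := by
  simp [isSelfAdjoint_iff, reOp, ← star_eq_adjoint, add_comm]

lemma isSelfAdjoint_imOp (A : H →L[ℂ] H) : IsSelfAdjoint (imOp A) := by
  rw [isSelfAdjoint_iff, imOp, ← star_eq_adjoint, star_smul, star_sub, star_star, ← neg_sub,
    smul_neg, ← neg_smul]
  simp

lemma norm_reOp_le_numRad (A : H →L[ℂ] H) : ‖reOp A‖ ≤ numRad A := by
  refine norm_le_of_isSelfAdjoint (isSelfAdjoint_reOp A) fun x hx ↦ ?_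
  have h := norm_inner_le_numRad A hx
  have h' : ‖⟪x, A x⟫_ℂ‖ ≤ numRad A := by rwa [norm_inner_symm]
  rw [reOp, smul_apply, add_apply, inner_smul_left, inner_add_left, adjoint_inner_left, norm_mul]
  have := norm_add_le ⟪A x, x⟫_ℂ ⟪x, A x⟫_ℂ
  norm_num
  linarith

lemma norm_imOp_le_numRad (A : H →L[ℂ] H) : ‖imOp A‖ ≤ numRad A := by
  refine norm_le_of_isSelfAdjoint (isSelfAdjoint_imOp A) fun x hx ↦ ?_
  have h := norm_inner_le_numRad A hx
  have h' : ‖⟪x, A x⟫_ℂ‖ ≤ numRad A := by rwa [norm_inner_symm]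
  rw [imOp, smul_apply, sub_apply, inner_smul_left, inner_sub_left, adjoint_inner_left, norm_mul]
  have := norm_sub_le ⟪A x, x⟫_ℂ ⟪x, A x⟫_ℂ
  norm_num
  linarith

lemma reOp_sq (A : H →L[ℂ] H) : reOp (A ^ 2) = reOp A * reOp A - imOp A * imOp A := by
  have hI : (2 * Complex.I)⁻¹ * (2 * Complex.I)⁻¹ = -((2 : ℂ)⁻¹ * (2 : ℂ)⁻¹) := by
    rw [← mul_inv, ← mul_inv, ← inv_neg]
    congr 1
    linear_combination 4 * Complex.I_mul_I
  have h2 : (2 : ℂ)⁻¹ = (2 : ℂ)⁻¹ * (2 : ℂ)⁻¹ * 2 := by norm_num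
  simp only [reOp, imOp, ← star_eq_adjoint, star_pow, smul_mul_smul_comm, hI, neg_smul,
    sub_neg_eq_add, ← smul_add]
  rw [h2, mul_smul, ← h2, two_smul]
  congr 1
  noncomm_ring

lemma norm_reOp_sq_le (A : H →L[ℂ] H) : ‖reOp (A ^ 2)‖ ≤ numRad A ^ 2 := by
  refine norm_le_of_isSelfAdjoint (isSelfAdjoint_reOp _) fun x hx ↦ ?_
  have hre := (reOp A).le_of_opNorm_le (norm_reOp_le_numRad A) x
  have him := (imOp A).le_of_opNorm_le (norm_imOp_le_numRad A) x
  rw [hx, mul_one] at hre him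
  rw [reOp_sq, sub_apply, inner_sub_left,
    inner_mul_self_of_isSelfAdjoint (isSelfAdjoint_reOp A),
    inner_mul_self_of_isSelfAdjoint (isSelfAdjoint_imOp A),
    inner_self_eq_norm_sq_to_K, inner_self_eq_norm_sq_to_K]
  have hre' := pow_le_pow_left₀ (norm_nonneg _) hre 2
  have him' := pow_le_pow_left₀ (norm_nonneg _) him 2
  have hre0 := sq_nonneg ‖reOp A x‖
  have him0 := sq_nonneg ‖imOp A x‖
  have : ‖((‖reOp A x‖ : ℂ) ^ 2 - (‖imOp A x‖ : ℂ) ^ 2)‖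
      = |‖reOp A x‖ ^ 2 - ‖imOp A x‖ ^ 2| := by
    rw [← Real.norm_eq_abs, ← Complex.norm_real]
    push_cast
    rfl
  refine this.le.trans (abs_le.2 ⟨?_, ?_⟩) <;> linarith

/-- The quadratic form of `P + iQ` has modulus `√(⟨Px,x⟩² + ⟨Qx,x⟩²)` for nonnegative `P`, `Q`. -/
lemma norm_inner_add_I_smul_sq {P Q : H →L[ℂ] H} (hP : 0 ≤ P) (hQ : 0 ≤ Q) (x : H) :
    ‖⟪(P + Complex.I • Q) x, x⟫_ℂ‖ ^ 2 = (⟪P x, x⟫_ℂ).re ^ 2 + (⟪Q x, x⟫_ℂ).re ^ 2 := by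
  have him {T : H →L[ℂ] H} (hT : 0 ≤ T) : (⟪T x, x⟫_ℂ).im = 0 :=
    (Complex.nonneg_iff.1 (((nonneg_iff_isPositive T).1 hT).inner_nonneg_left x)).2.symm
  rw [← Complex.normSq_eq_norm_sq, Complex.normSq_apply]
  simp only [add_apply, smul_apply, inner_add_left, inner_smul_left, Complex.conj_I,
    Complex.add_re, Complex.add_im, Complex.mul_re, Complex.mul_im, Complex.neg_re, Complex.neg_im,
    Complex.I_re, Complex.I_im, him hP, him hQ]
  ring

lemma numRad_add_I_smul_comm {P Q : H →L[ℂ] H} (hP : 0 ≤ P) (hQ : 0 ≤ Q) :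
    numRad (P + Complex.I • Q) = numRad (Q + Complex.I • P) := by
  refine congrArg iSup (funext fun x ↦ ?_)
  rw [← sq_eq_sq₀ (norm_nonneg _) (norm_nonneg _), norm_inner_add_I_smul_sq hP hQ,
    norm_inner_add_I_smul_sq hQ hP, add_comm]

theorem stmt6 (A : H →L[ℂ] H) :
    (1/2) * ‖reOp (A ^ 2)‖ + (1/2) * numRad A * |‖reOp A‖ - ‖imOp A‖|
      ≤ (numRad A) ^ 2 ∧
    (numRad A) ^ 2 ≤ (1/2) * numRad (opAbs A + Complex.I • opAbs (adjoint A)) *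
        numRad (opAbs (adjoint A) + Complex.I • opAbs A) := by
  constructor
  · have hdiff : |‖reOp A‖ - ‖imOp A‖| ≤ numRad A := by
      have := norm_reOp_le_numRad A
      have := norm_imOp_le_numRad A
      have := norm_nonneg (reOp A)
      have := norm_nonneg (imOp A)
      exact abs_le.2 ⟨by linarith, by linarith⟩
    have := norm_reOp_sq_le A
    have := mul_le_mul_of_nonneg_left hdiff (numRad_nonneg A)
    nlinarith
  · have hP := opAbs_nonneg A
    have hQ := opAbs_nonneg (adjoint A)
    rw [← numRad_add_I_smul_comm hP hQ, mul_assoc, ← sq]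
    set w := numRad (opAbs A + Complex.I • opAbs (adjoint A))
    refine (Real.le_sqrt (numRad_nonneg A) (by positivity)).1 (numRad_le fun x hx ↦ ?_)
    refine Real.le_sqrt_of_sq_le ?_
    have hmixed := norm_inner_sq_le_opAbs A x x
    have hw := pow_le_pow_left₀ (norm_nonneg _)
      (norm_inner_le_numRad (opAbs A + Complex.I • opAbs (adjoint A)) hx) 2
    rw [norm_inner_add_I_smul_sq hP hQ] at hw
    linarith [two_mul_le_add_sq (⟪opAbs A x, x⟫_ℂ).re (⟪opAbs (adjoint A) x, x⟫_ℂ).re]
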